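/- For all k ≥ 1 and all homogeneous matrices X₁, …, X_{2k+1} ∈ gl(p,q): str(𝒜_{2k+1}(X₁,…,X_{2k+1})) = (2k+1) · str(𝒜_{2k}(X₁,…,X_{2k}) · X_{2k+1}). -/

import Mathlib

open Matrix

/-- Index type for the ℤ₂-graded space ℂ^p ⊕ ℂ^q. -/
abbrev Idx (p q : ℕ) := Sum (Fin p) (Fin q)

/-- Parity of a basis index. -/
def ipar {p q : ℕ} : Idx p q → ZMod 2
  | Sum.inl _ => 0
  | Sum.inr _ => 1

/-- `(-1)^a` for `a : ZMod 2`. -/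
noncomputable def sgn (a : ZMod 2) : ℂ := if a = 1 then -1 else 1

/-- A matrix is homogeneous of parity `ε` iff it maps the graded piece of
parity `a` into the piece of parity `a + ε`; equivalently, its entry `X i j`
vanishes unless `ipar i = ipar j + ε`. -/
def HasParity {p q : ℕ} (X : Matrix (Idx p q) (Idx p q) ℂ) (ε : ZMod 2) : Prop :=
  ∀ i j, ipar i ≠ ipar j + ε → X i j = 0

/-- A vector is homogeneous of parity `ε`. -/
def VHasParity {p q : ℕ} (u : Idx p q → ℂ) (ε : ZMod 2) : Prop :=
  ∀ i, ipar i ≠ ε → u i = 0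

/-- The super sign `ε(σ, 𝒳) = (-1)^{K(σ,𝒳)}`, where `K(σ,𝒳)` is the number of
pairs `(i,j)` with `i < j`, `σ i > σ j` and both `X (σ i)`, `X (σ j)` odd
(here only the parities `px` of the `X`'s matter). -/
noncomputable def superSign {k : ℕ} (σ : Equiv.Perm (Fin k)) (px : Fin k → ZMod 2) : ℂ :=
  (-1 : ℂ) ^ (Finset.univ.filter (fun ij : Fin k × Fin k =>
      ij.1 < ij.2 ∧ σ ij.2 < σ ij.1 ∧ px (σ ij.1) = 1 ∧ px (σ ij.2) = 1)).card

/-- The ordered matrix product `X (σ 0) * X (σ 1) * ⋯ * X (σ (k-1))`. -/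
noncomputable def permProd {k p q : ℕ} (σ : Equiv.Perm (Fin k))
    (X : Fin k → Matrix (Idx p q) (Idx p q) ℂ) : Matrix (Idx p q) (Idx p q) ℂ :=
  (List.ofFn fun i => X (σ i)).prod

/-- The standard supersymmetric super polynomial `𝒫_k`. -/
noncomputable def symPoly {k p q : ℕ} (X : Fin k → Matrix (Idx p q) (Idx p q) ℂ)
    (px : Fin k → ZMod 2) : Matrix (Idx p q) (Idx p q) ℂ :=
  ∑ σ : Equiv.Perm (Fin k), superSign σ px • permProd σ X

/-- The standard skew supersymmetric super polynomial `𝒜_k`. -/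
noncomputable def skewPoly {k p q : ℕ} (X : Fin k → Matrix (Idx p q) (Idx p q) ℂ)
    (px : Fin k → ZMod 2) : Matrix (Idx p q) (Idx p q) ℂ :=
  ∑ σ : Equiv.Perm (Fin k),
    (((Equiv.Perm.sign σ : ℤ) : ℂ) * superSign σ px) • permProd σ X

/-- The supertrace `str X = tr A - tr D` of a matrix in `gl(p,q)`. -/
noncomputable def strace {p q : ℕ} (X : Matrix (Idx p q) (Idx p q) ℂ) : ℂ :=
  ∑ i : Fin p, X (Sum.inl i) (Sum.inl i) - ∑ j : Fin q, X (Sum.inr j) (Sum.inr j)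

/-- The super bracket `[A,B] = AB - (-1)^{|A||B|} BA` of homogeneous matrices
`A`, `B` of parities `a`, `b`. -/
noncomputable def sbr {p q : ℕ} (A : Matrix (Idx p q) (Idx p q) ℂ) (a : ZMod 2)
    (B : Matrix (Idx p q) (Idx p q) ℂ) (b : ZMod 2) : Matrix (Idx p q) (Idx p q) ℂ :=
  A * B - sgn (a * b) • (B * A)

/-- The matrix of the even bilinear form `B` on `ℂ ⊕ ℂ^{2n}`: it is `1` on the
even line, `0` between the even and odd parts, and the standard symplectic form
with matrix `[[0, Iₙ],[-Iₙ, 0]]` on `ℂ^{2n}`. -/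
noncomputable def Bmat (n : ℕ) : Matrix (Idx 1 (2*n)) (Idx 1 (2*n)) ℂ :=
  fun i j => match i, j with
  | Sum.inl _, Sum.inl _ => 1
  | Sum.inl _, Sum.inr _ => 0
  | Sum.inr _, Sum.inl _ => 0
  | Sum.inr a, Sum.inr b =>
      if a.val + n = b.val then 1 else if b.val + n = a.val then -1 else 0

/-- The bilinear form `B(u,v)` on `ℂ ⊕ ℂ^{2n}`. -/
noncomputable def Bform (n : ℕ) (u v : Idx 1 (2*n) → ℂ) : ℂ :=
  ∑ i, ∑ j, u i * Bmat n i j * v j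

/-- `X` is a homogeneous element of `osp(1,2n)` of parity `ε`:
`B(Xu,v) + (-1)^{|X||u|} B(u,Xv) = 0` for all homogeneous `u`, `v`. -/
def ospMem {n : ℕ} (X : Matrix (Idx 1 (2*n)) (Idx 1 (2*n)) ℂ) (ε : ZMod 2) : Prop :=
  HasParity X ε ∧
  ∀ (u v : Idx 1 (2*n) → ℂ) (εu εv : ZMod 2), VHasParity u εu → VHasParity v εv →
    Bform n (X.mulVec u) v + sgn (ε * εu) * Bform n u (X.mulVec v) = 0

/-- The super sign as a product over ordered pairs of positions. -/
theorem superSign_eq_prod {k : ℕ} (σ : Equiv.Perm (Fin k)) (px : Fin k → ZMod 2) :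
    superSign σ px = ∏ i, ∏ j, if i < j then
      (if σ j < σ i ∧ px (σ i) = 1 ∧ px (σ j) = 1 then (-1 : ℂ) else 1) else 1 := by
  rw [superSign, ← Fintype.prod_prod_type', ← Finset.prod_const, Finset.prod_filter]
  refine Finset.prod_congr rfl fun x _ => ?_
  by_cases h : x.1 < x.2 <;> simp [h]

/-- Splitting off the first position of a product over ordered pairs. -/
theorem prod_lt_succ {n : ℕ} (w : Fin (n + 1) → Fin (n + 1) → ℂ) :
    (∏ i, ∏ j, if i < j then w i j else 1) =
      (∏ j : Fin n, w 0 j.succ) * ∏ i : Fin n, ∏ j : Fin n,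
        if i < j then w i.succ j.succ else 1 := by
  simp [Fin.prod_univ_succ]

/-- Splitting off the last position of a product over ordered pairs. -/
theorem prod_lt_castSucc {n : ℕ} (w : Fin (n + 1) → Fin (n + 1) → ℂ) :
    (∏ i, ∏ j, if i < j then w i j else 1) =
      (∏ i : Fin n, w i.castSucc (Fin.last n)) * ∏ i : Fin n, ∏ j : Fin n,
        if i < j then w i.castSucc j.castSucc else 1 := by
  simp [Fin.prod_univ_castSucc, Finset.prod_mul_distrib, mul_comm, Fin.not_lt.2 (Fin.le_last _)]

theorem sgn_add (a b : ZMod 2) : sgn (a + b) = sgn a * sgn b := by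
  have h : ∀ c : ZMod 2, c = 0 ∨ c = 1 := by decide
  rcases h a with rfl | rfl <;> rcases h b with rfl | rfl <;> simp [sgn, CharTwo.add_self_eq_zero]

theorem sgn_sum {ι : Type*} (s : Finset ι) (f : ι → ZMod 2) :
    sgn (∑ i ∈ s, f i) = ∏ i ∈ s, sgn (f i) := by
  classical
  induction s using Finset.induction_on with
  | empty => simp [sgn]
  | insert a s ha ih => rw [Finset.sum_insert ha, Finset.prod_insert ha, sgn_add, ih]

theorem sgn_mul_self (a : ZMod 2) : sgn a * sgn a = 1 := by
  by_cases h : a = 1 <;> simp [sgn, h]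

theorem sgn_mul_eq_ite (a b : ZMod 2) : sgn (a * b) = if a = 1 ∧ b = 1 then -1 else 1 := by
  have h : ∀ c : ZMod 2, c = 0 ∨ c = 1 := by decide
  rcases h a with rfl | rfl <;> rcases h b with rfl | rfl <;> simp [sgn]

/-- Moving the first entry to the end changes the super sign by the sign of commuting
the first entry past all the others. -/
theorem superSign_mul_finRotate {n : ℕ} (σ : Equiv.Perm (Fin (n + 1)))
    (px : Fin (n + 1) → ZMod 2) :
    superSign (σ * finRotate (n + 1)) px =
      sgn (px (σ 0) * ∑ j : Fin n, px (σ j.succ)) * superSign σ px := by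
  rw [superSign_eq_prod, superSign_eq_prod, prod_lt_castSucc, prod_lt_succ, ← mul_assoc,
    Finset.mul_sum, sgn_sum]
  simp only [Equiv.Perm.mul_apply, finRotate_apply, Fin.coeSucc_eq_succ, Fin.last_add_one]
  congr 1
  rw [← Finset.prod_mul_distrib]
  refine Finset.prod_congr rfl fun j _ => ?_
  have hne : σ 0 ≠ σ j.succ := fun h => (Fin.succ_ne_zero j) (σ.injective h).symm
  rw [sgn_mul_eq_ite]
  rcases lt_or_gt_of_ne hne with h | h <;>
    by_cases h1 : px (σ 0) = 1 <;> by_cases h2 : px (σ j.succ) = 1 <;>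
      simp [h, h.not_gt, h1, h2]

theorem HasParity.mul {p q : ℕ} {A B : Matrix (Idx p q) (Idx p q) ℂ} {a b : ZMod 2}
    (hA : HasParity A a) (hB : HasParity B b) : HasParity (A * B) (a + b) := by
  intro i j hij
  rw [Matrix.mul_apply]
  refine Finset.sum_eq_zero fun l _ => ?_
  by_cases h1 : ipar i = ipar l + a
  · rw [hB l j, mul_zero]
    intro h2
    apply hij
    rw [h1, h2]
    ring
  · rw [hA i l h1, zero_mul]

theorem hasParity_one {p q : ℕ} : HasParity (1 : Matrix (Idx p q) (Idx p q) ℂ) 0 := by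
  intro i j hij
  refine Matrix.one_apply_ne fun h => hij ?_
  rw [h, add_zero]

theorem HasParity.list_prod_ofFn {p q : ℕ} : ∀ {n : ℕ}
    {X : Fin n → Matrix (Idx p q) (Idx p q) ℂ} {px : Fin n → ZMod 2},
    (∀ i, HasParity (X i) (px i)) → HasParity (List.ofFn X).prod (∑ i, px i)
  | 0, _, _, _ => by simpa using hasParity_one
  | n + 1, X, px, h => by
    rw [List.ofFn_succ, List.prod_cons, Fin.sum_univ_succ]
    exact (h 0).mul (list_prod_ofFn fun i => h i.succ)

theorem strace_eq_sum {p q : ℕ} (A : Matrix (Idx p q) (Idx p q) ℂ) :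
    strace A = ∑ i, sgn (ipar i) * A i i := by
  simp [strace, sgn, ipar, sub_eq_add_neg]

/-- The supertrace is supersymmetric. -/
theorem strace_mul_comm {p q : ℕ} {A B : Matrix (Idx p q) (Idx p q) ℂ} {a b : ZMod 2}
    (hA : HasParity A a) (hB : HasParity B b) :
    strace (A * B) = sgn (a * b) * strace (B * A) := by
  simp only [strace_eq_sum, Matrix.mul_apply, Finset.mul_sum]
  rw [Finset.sum_comm]
  refine Finset.sum_congr rfl fun j _ => Finset.sum_congr rfl fun i _ => ?_
  by_cases h1 : ipar i = ipar j + a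
  · by_cases h2 : ipar j = ipar i + b
    · have hab : b = a := by
        rw [h1, add_assoc, left_eq_add] at h2
        rw [← sub_eq_zero, CharTwo.sub_eq_add, add_comm, h2]
      have haa : a * a = a := (by decide : ∀ c : ZMod 2, c * c = c) a
      rw [h1, hab, haa, sgn_add]
      ring
    · rw [hB j i h2]; ring
  · rw [hA i j h1]; ring

theorem strace_sum {p q : ℕ} {ι : Type*} (s : Finset ι)
    (f : ι → Matrix (Idx p q) (Idx p q) ℂ) :
    strace (∑ i ∈ s, f i) = ∑ i ∈ s, strace (f i) := by
  simp only [strace_eq_sum, Matrix.sum_apply, Finset.mul_sum]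
  exact Finset.sum_comm

theorem strace_smul {p q : ℕ} (c : ℂ) (A : Matrix (Idx p q) (Idx p q) ℂ) :
    strace (c • A) = c * strace A := by
  simp only [strace_eq_sum, Matrix.smul_apply, smul_eq_mul, Finset.mul_sum]
  exact Finset.sum_congr rfl fun i _ => by ring

/-- The supertrace of the summand of `skewPoly X px` indexed by `σ`. -/
noncomputable def skewTerm {k p q : ℕ} (X : Fin k → Matrix (Idx p q) (Idx p q) ℂ)
    (px : Fin k → ZMod 2) (σ : Equiv.Perm (Fin k)) : ℂ :=
  ((Equiv.Perm.sign σ : ℤ) : ℂ) * superSign σ px * strace (permProd σ X)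

theorem permProd_mul_finRotate {n p q : ℕ} (σ : Equiv.Perm (Fin (n + 1)))
    (X : Fin (n + 1) → Matrix (Idx p q) (Idx p q) ℂ) :
    permProd (σ * finRotate (n + 1)) X =
      (List.ofFn fun i : Fin n => X (σ i.succ)).prod * X (σ 0) := by
  rw [permProd, List.ofFn_succ_last, List.prod_append]
  simp only [Equiv.Perm.mul_apply, finRotate_apply, Fin.coeSucc_eq_succ, Fin.last_add_one,
    List.prod_singleton]

/-- For an odd number of matrices the terms of the skew polynomial have supertraces invariant
under cyclic rotation. -/
theorem skewTerm_mul_finRotate {n p q : ℕ} (hn : Even n)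
    (X : Fin (n + 1) → Matrix (Idx p q) (Idx p q) ℂ) (px : Fin (n + 1) → ZMod 2)
    (hX : ∀ i, HasParity (X i) (px i)) (σ : Equiv.Perm (Fin (n + 1))) :
    skewTerm X px (σ * finRotate (n + 1)) = skewTerm X px σ := by
  have hs : strace (permProd (σ * finRotate (n + 1)) X) =
      sgn (px (σ 0) * ∑ j : Fin n, px (σ j.succ)) * strace (permProd σ X) := by
    rw [permProd_mul_finRotate,
      strace_mul_comm (HasParity.list_prod_ofFn fun i : Fin n => hX (σ i.succ)) (hX (σ 0)),
      permProd, List.ofFn_succ, List.prod_cons, mul_comm (px (σ 0))]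
  rw [skewTerm, skewTerm, hs, superSign_mul_finRotate, Equiv.Perm.sign_mul, sign_finRotate,
    Nat.add_sub_cancel, hn.neg_one_pow, mul_one]
  linear_combination (((Equiv.Perm.sign σ : ℤ) : ℂ) * superSign σ px * strace (permProd σ X)) *
    sgn_mul_self (px (σ 0) * ∑ j : Fin n, px (σ j.succ))

theorem finRotate_pow_succ_last {n : ℕ} (m : ℕ) (hm : m < n + 1) :
    (finRotate (n + 1) ^ (m + 1)) (Fin.last n) = ⟨m, hm⟩ := by
  induction m with
  | zero => simp
  | succ m ih =>
    rw [pow_succ', Equiv.Perm.mul_apply, ih (by lia), finRotate_of_lt (by lia)]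

/-- A rotation-invariant function on permutations has sum `n + 1` times its sum over the
permutations fixing the last point. -/
theorem sum_perm_eq_of_rotate_invariant {n : ℕ} (T : Equiv.Perm (Fin (n + 1)) → ℂ)
    (hT : ∀ σ, T (σ * finRotate (n + 1)) = T σ) :
    ∑ σ, T σ = (n + 1 : ℂ) * ∑ σ, if σ (Fin.last n) = Fin.last n then T σ else 0 := by
  have hpow : ∀ (m : ℕ) σ, T (σ * finRotate (n + 1) ^ m) = T σ := by
    intro m
    induction m with
    | zero => simp
    | succ m ih => intro σ; rw [pow_succ, ← mul_assoc, hT, ih]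
  have hj : ∀ j : Fin (n + 1), (∑ σ, if σ j = Fin.last n then T σ else 0) =
      ∑ σ, if σ (Fin.last n) = Fin.last n then T σ else 0 := by
    intro j
    have hlast : (finRotate (n + 1) ^ (j.val + 1)) (Fin.last n) = j :=
      finRotate_pow_succ_last j.val j.isLt
    rw [← Equiv.sum_comp (Equiv.mulRight (finRotate (n + 1) ^ (j.val + 1)))
      (fun σ : Equiv.Perm (Fin (n + 1)) => if σ (Fin.last n) = Fin.last n then T σ else 0)]
    refine Finset.sum_congr rfl fun σ _ => ?_
    rw [Equiv.coe_mulRight, hpow, Equiv.Perm.mul_apply, hlast]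
  have hsplit : ∀ σ, T σ = ∑ j, if σ j = Fin.last n then T σ else 0 := by
    intro σ
    rw [Equiv.sum_comp σ (fun i => if i = Fin.last n then T σ else 0)]
    simp
  rw [Finset.sum_congr rfl fun σ _ => hsplit σ, Finset.sum_comm,
    Finset.sum_congr rfl fun j _ => hj j]
  simp

/-- Extension of a permutation of `Fin n` to `Fin (n + 1)` fixing the last point. -/
def extendLast {n : ℕ} (τ : Equiv.Perm (Fin n)) : Equiv.Perm (Fin (n + 1)) :=
  finSuccEquivLast.symm.permCongr (Equiv.optionCongr τ)

@[simp] theorem extendLast_castSucc {n : ℕ} (τ : Equiv.Perm (Fin n)) (i : Fin n) :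
    extendLast τ i.castSucc = (τ i).castSucc := by
  simp [extendLast, Equiv.permCongr_apply]

@[simp] theorem extendLast_last {n : ℕ} (τ : Equiv.Perm (Fin n)) :
    extendLast τ (Fin.last n) = Fin.last n := by
  simp [extendLast, Equiv.permCongr_apply]

theorem sign_extendLast {n : ℕ} (τ : Equiv.Perm (Fin n)) :
    Equiv.Perm.sign (extendLast τ) = Equiv.Perm.sign τ := by
  rw [extendLast, Equiv.Perm.sign_permCongr, Equiv.optionCongr_sign]

theorem sum_perm_fix_last {n : ℕ} (T : Equiv.Perm (Fin (n + 1)) → ℂ) :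
    (∑ σ, if σ (Fin.last n) = Fin.last n then T σ else 0) = ∑ τ, T (extendLast τ) := by
  symm
  rw [← Finset.sum_filter]
  refine Finset.sum_bij (fun τ _ => extendLast τ) (fun τ _ => by simp) ?_ ?_ fun _ _ => rfl
  · intro τ _ τ' _ h
    exact Equiv.optionCongr_injective (finSuccEquivLast.symm.permCongr.injective h)
  · intro σ hσ
    have hσ' : σ (Fin.last n) = Fin.last n := by simpa using hσ
    have hnone : finSuccEquivLast.permCongr σ none = none := by
      simp [Equiv.permCongr_apply, hσ']
    refine ⟨Equiv.removeNone (finSuccEquivLast.permCongr σ), Finset.mem_univ _, ?_⟩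
    rw [extendLast, map_equiv_removeNone, hnone, Equiv.swap_self]
    ext i
    simp [Equiv.permCongr_apply]

theorem superSign_extendLast {n : ℕ} (τ : Equiv.Perm (Fin n)) (px : Fin (n + 1) → ZMod 2) :
    superSign (extendLast τ) px = superSign τ fun i => px i.castSucc := by
  rw [superSign_eq_prod, superSign_eq_prod, prod_lt_castSucc]
  simp [Fin.not_lt.2 (Fin.le_last _)]

theorem permProd_extendLast {n p q : ℕ} (τ : Equiv.Perm (Fin n))
    (X : Fin (n + 1) → Matrix (Idx p q) (Idx p q) ℂ) :
    permProd (extendLast τ) X = permProd τ (fun i => X i.castSucc) * X (Fin.last n) := by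
  rw [permProd, permProd, List.ofFn_succ_last, List.prod_append]
  simp

/-- `str (𝒜_{2k+1}(X₁,…,X_{2k+1})) = (2k+1) ⋅ str (𝒜_{2k}(X₁,…,X_{2k}) ⬝ X_{2k+1})`. -/
theorem strace_skewPoly_odd (p q k : ℕ) (hk : 1 ≤ k)
    (X : Fin (2*k+1) → Matrix (Idx p q) (Idx p q) ℂ)
    (px : Fin (2*k+1) → ZMod 2) (hX : ∀ i, HasParity (X i) (px i)) :
    strace (skewPoly X px) =
      (2*k+1 : ℂ) * strace
        (skewPoly (fun i : Fin (2*k) => X i.castSucc) (fun i => px i.castSucc)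
          * X (Fin.last (2*k))) := by
  have hleft : strace (skewPoly X px) = ∑ σ, skewTerm X px σ := by
    rw [skewPoly, strace_sum]
    exact Finset.sum_congr rfl fun σ _ => strace_smul _ _
  rw [hleft, sum_perm_eq_of_rotate_invariant _
    (skewTerm_mul_finRotate (even_two_mul k) X px hX), sum_perm_fix_last, skewPoly,
    Finset.sum_mul, strace_sum]
  push_cast
  congr 1
  refine Finset.sum_congr rfl fun τ _ => ?_
  rw [skewTerm, sign_extendLast, superSign_extendLast, permProd_extendLast, Matrix.smul_mul,
    strace_smul]
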